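/- Let f ∈ L¹(ℍⁿ) and let g ∈ L¹(ℍⁿ) be radial. Then for every k ∈ ℕ, every λ ≠ 0 and every z ∈ ℂⁿ, with a = (λ,(2k+n)|λ|), the Strichartz Fourier transform of the convolution f∗g satisfies (f∗g)̂(a,z) = R_k(−λ, g) · f̂(a,z). -/

import Mathlib

open MeasureTheory Complex Real Filter

noncomputable section

/-- ℂⁿ with its Euclidean (Hilbert space) structure. -/
abbrev Cn (n : ℕ) := EuclideanSpace ℂ (Fin n)

instance (n : ℕ) : MeasurableSpace (Cn n) := borel _
instance (n : ℕ) : BorelSpace (Cn n) := ⟨rfl⟩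
instance (n : ℕ) : InnerProductSpace ℝ (Cn n) := InnerProductSpace.rclikeToReal ℂ (Cn n)

/-- The Heisenberg group ℍⁿ = ℂⁿ × ℝ (as a measure space with Lebesgue/Haar measure). -/
abbrev Hn (n : ℕ) := Cn n × ℝ

/-- Im (z · w̄) = Im (∑ⱼ zⱼ conj wⱼ). -/
def imZW {n : ℕ} (z w : Cn n) : ℝ := (∑ j, z j * (starRingEnd ℂ) (w j)).im

/-- The λ-twisted convolution F ∗_λ G (z) = ∫ F(z−w) G(w) e^{(i/2)λ Im(z·w̄)} dw. -/
def twConv (n : ℕ) (lam : ℝ) (F G : Cn n → ℂ) (z : Cn n) : ℂ :=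
  ∫ w : Cn n, F (z - w) * G w * Complex.exp
    (Complex.I / 2 * (lam : ℂ) * ((imZW z w : ℝ) : ℂ))

/-- The inverse Fourier transform in the central variable, f^λ(z) = ∫ e^{iλt} f(z,t) dt. -/
def fLam (n : ℕ) (f : Hn n → ℂ) (lam : ℝ) (z : Cn n) : ℂ :=
  ∫ t : ℝ, Complex.exp (Complex.I * (lam : ℂ) * (t : ℂ)) * f (z, t)

/-- The Laguerre polynomial of type m−1:
L_k^{m−1}(t) = ∑_{j=0}^k binom(k+m−1, k−j) (−t)^j / j!. -/
def lagPoly (m k : ℕ) (t : ℝ) : ℝ :=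
  ∑ j ∈ Finset.range (k + 1), ((k + m - 1).choose (k - j) : ℝ) * (-t) ^ j / (Nat.factorial j)

/-- The Laguerre function φ_{k,λ}^{m−1}(z) = L_k^{m−1}(|λ||z|²/2) e^{−|λ||z|²/4} on ℂ^m. -/
def lagFun (m k : ℕ) (lam : ℝ) (z : Cn m) : ℝ :=
  lagPoly m k (|lam| * ‖z‖ ^ 2 / 2) * Real.exp (-(|lam| * ‖z‖ ^ 2 / 4))

/-- The Strichartz Fourier transform f̂(a,z) = f^{−λ} ∗_{−λ} φ_{k,λ}(z)
at the point a = (λ, (2k+n)|λ|) of the ray R_k. -/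
def stri (n : ℕ) (f : Hn n → ℂ) (k : ℕ) (lam : ℝ) (z : Cn n) : ℂ :=
  twConv n (-lam) (fLam n f (-lam)) (fun w => ((lagFun n k lam w : ℝ) : ℂ)) z

/-- The normalizing constant k!(n−1)!/(k+n−1)!. -/
def normC (n k : ℕ) : ℝ :=
  (Nat.factorial k * Nat.factorial (n - 1) : ℝ) / (Nat.factorial (k + n - 1))

/-- The Bessel kernel J_{n−1}(s)/s^{n−1}, extended by its limiting value
1/(2^{n−1}(n−1)!) at s = 0, given by its power series. -/
def besselKer (n : ℕ) (s : ℝ) : ℝ :=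
  ∑' m : ℕ, (-1 : ℝ) ^ m / (Nat.factorial m * Nat.factorial (m + n - 1)) *
    s ^ (2 * m) / 2 ^ (2 * m + n - 1)

/-- The Strichartz Fourier transform f̂((0,τ),z) on the limiting ray R_∞. -/
def striLim (n : ℕ) (f : Hn n → ℂ) (z : Cn n) (τ : ℝ) : ℂ :=
  ((Nat.factorial (n - 1) * 2 ^ (n - 1) : ℝ) : ℂ) *
    ∫ w : Cn n, fLam n f 0 (z - w) * ((besselKer n (Real.sqrt τ * ‖w‖) : ℝ) : ℂ)

/-- The Heisenberg fan Ω ⊆ ℝ²: union of the rays R_k, k ∈ ℕ, and the limiting ray R_∞. -/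
def fan (n : ℕ) : Set (ℝ × ℝ) :=
  {a | (∃ k : ℕ, a.1 ≠ 0 ∧ a.2 = (2 * k + n) * |a.1|) ∨ (a.1 = 0 ∧ 0 ≤ a.2)}

open scoped Classical in
/-- The index k of the ray R_k through a point of the fan (junk value otherwise). -/
def fanK (n : ℕ) (a : ℝ × ℝ) : ℕ :=
  if h : ∃ k : ℕ, a.2 = (2 * k + n) * |a.1| then h.choose else 0

/-- The normalized Strichartz Fourier transform f̃(a,z), as a function of a ∈ Ω. -/
def striNorm (n : ℕ) (f : Hn n → ℂ) (z : Cn n) (a : ℝ × ℝ) : ℂ :=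
  if a.1 = 0 then striLim n f z a.2
  else ((normC n (fanK n a) : ℝ) : ℂ) * stri n f (fanK n a) a.1 z

/-- The Plancherel measure ν on the Heisenberg fan:
∫ φ dν = (2π)^{−2n−1} ∫_ℝ (∑_k φ(λ,(2k+n)|λ|)) |λ|^{2n} dλ. -/
def fanMeasure (n : ℕ) : Measure (ℝ × ℝ) :=
  (ENNReal.ofReal ((2 * π) ^ (2 * n + 1)))⁻¹ •
    Measure.sum (fun k : ℕ =>
      Measure.map (fun lam : ℝ => (lam, (2 * k + n) * |lam|))
        (volume.withDensity fun lam => ENNReal.ofReal (|lam| ^ (2 * n))))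

/-- A function on ℍⁿ is radial if it is invariant under the action of the unitary group U(n). -/
def IsRadial (n : ℕ) (g : Hn n → ℂ) : Prop :=
  ∀ (U : Cn n ≃ₗᵢ[ℂ] Cn n) (x : Hn n), g (U x.1, x.2) = g x

/-- The k-th Laguerre coefficient R_k(λ, f) = (k!(n−1)!/(k+n−1)!) ∫ f^λ(w) φ_{k,λ}(w) dw. -/
def lagCoef (n : ℕ) (k : ℕ) (lam : ℝ) (f : Hn n → ℂ) : ℂ :=
  ((normC n k : ℝ) : ℂ) * ∫ w : Cn n, fLam n f lam w * ((lagFun n k lam w : ℝ) : ℂ)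

/-- The Gelfand (spherical Fourier) transform of a radial function on ℍ^m, evaluated at
(λ, (2j+m)|λ|). -/
def gelfand (m : ℕ) (h : Hn m → ℂ) (lam : ℝ) (j : ℕ) : ℂ :=
  ((normC m j : ℝ) : ℂ) *
    ∫ x : Hn m, h x * Complex.exp (Complex.I * (lam : ℂ) * (x.2 : ℂ)) *
      ((lagFun m j lam x.1 : ℝ) : ℂ)

/-- The group convolution on ℍⁿ: f∗g(x) = ∫ f(x·y⁻¹) g(y) dy. -/
def hConv (n : ℕ) (f g : Hn n → ℂ) (x : Hn n) : ℂ :=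
  ∫ y : Hn n, f (x.1 - y.1, x.2 - y.2 - imZW x.1 y.1 / 2) * g y

/-- P is a bigraded solid harmonic of degree (p,q) on ℂⁿ: P(z) = ∑_{|α|=p,|β|=q} c_{αβ} z^α z̄^β,
harmonic as a function on ℝ^{2n} (the harmonicity Δ P = 0 is expressed by the equivalent
algebraic condition on the coefficients). -/
def IsBigradedSolidHarmonic (n p q : ℕ) (P : Cn n → ℂ) : Prop :=
  ∃ c : (Fin n → ℕ) → (Fin n → ℕ) → ℂ,
    (∀ z : Cn n, P z =
      ∑ α ∈ Finset.Nat.antidiagonalTuple n p, ∑ β ∈ Finset.Nat.antidiagonalTuple n q,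
        c α β * (∏ j, z j ^ α j) * ∏ j, (starRingEnd ℂ) (z j) ^ β j) ∧
    (∀ γ δ : Fin n → ℕ,
      ∑ j : Fin n, (((γ j + 1) * (δ j + 1) : ℕ) : ℂ) *
        c (Function.update γ j (γ j + 1)) (Function.update δ j (δ j + 1)) = 0)

/-- The physicists' Hermite polynomial H_m(x) = (−1)^m e^{x²} (d/dx)^m e^{−x²}. -/
def physHermite (m : ℕ) (x : ℝ) : ℝ :=
  (-1 : ℝ) ^ m * Real.exp (x ^ 2) * iteratedDeriv m (fun y => Real.exp (-(y ^ 2))) x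

/-- The normalized Hermite function h_m(x) = (2^m m! √π)^{−1/2} H_m(x) e^{−x²/2}. -/
def hermiteFun (m : ℕ) (x : ℝ) : ℝ :=
  (Real.sqrt (2 ^ m * (Nat.factorial m) * Real.sqrt π))⁻¹ * physHermite m x *
    Real.exp (-(x ^ 2) / 2)

/-- The scaled Hermite function Φ_α^λ(x) = |λ|^{n/4} ∏ⱼ h_{αⱼ}(√|λ| xⱼ). -/
def scaledHermite (n : ℕ) (lam : ℝ) (α : Fin n → ℕ) (x : Fin n → ℝ) : ℝ :=
  |lam| ^ ((n : ℝ) / 4) * ∏ j, hermiteFun (α j) (Real.sqrt |lam| * x j)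

/-- The Schrödinger representation: π_λ(z,t)φ(ξ) = e^{iλt} e^{iλ(x·ξ+(1/2)x·y)} φ(ξ+y),
z = x+iy. -/
def schrodinger (n : ℕ) (lam : ℝ) (zt : Hn n) (φ : (Fin n → ℝ) → ℂ) (ξ : Fin n → ℝ) : ℂ :=
  Complex.exp (Complex.I * (lam : ℂ) * (zt.2 : ℂ)) *
    Complex.exp (Complex.I * (lam : ℂ) *
      (((∑ j, (zt.1 j).re * ξ j) + (∑ j, (zt.1 j).re * (zt.1 j).im) / 2 : ℝ) : ℂ)) *
    φ (fun j => ξ j + (zt.1 j).im)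

/-- The group Fourier transform f̂(λ)φ = ∫ f(z,t) π_λ(z,t)φ dz dt. -/
def groupFT (n : ℕ) (f : Hn n → ℂ) (lam : ℝ) (φ : (Fin n → ℝ) → ℂ) (ξ : Fin n → ℝ) : ℂ :=
  ∫ x : Hn n, f x * schrodinger n lam x φ ξ

theorem Nat.add_choose_eq_sum_range (m n p r : ℕ) (hr : ∀ q, r < q → n.choose q = 0)
    (hrp : r ≤ p) :
    (m + n).choose p = ∑ q ∈ Finset.range (r + 1), m.choose (p - q) * n.choose q := by
  rw [Nat.add_comm m n, Nat.add_choose_eq, Finset.Nat.sum_antidiagonal_eq_sum_range_succ_mk]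
  symm
  apply Finset.sum_subset_zero_on_sdiff
  · intro x hx
    simp only [Finset.mem_range] at *
    omega
  · intro x hx
    simp only [Finset.mem_sdiff, Finset.mem_range] at hx
    simp [hr x (by omega)]
  · intro x _
    exact Nat.mul_comm _ _

theorem Nat.sum_choose_mul_choose_sub (a b j : ℕ) :
    ∑ q ∈ Finset.range (j + 1), a.choose q * b.choose (j - q) = (a + b).choose j := by
  rw [Nat.add_choose_eq, Finset.Nat.sum_antidiagonal_eq_sum_range_succ_mk]

/-- The Pfaff–Saalschütz summation, in binomial form. -/
theorem Nat.sum_choose_mul_choose_mul_choose (α i j k : ℕ) :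
    ∑ m ∈ Finset.range (j + 1),
      i.choose m * (α + j).choose (j - m) * (k + α + m).choose (α + i + j) =
    k.choose j * (k + α).choose (α + i) := by
  have h1 : ∀ m ∈ Finset.range (j + 1),
      i.choose m * (α + j).choose (j - m) * (k + α + m).choose (α + i + j) =
      ∑ q ∈ Finset.range (j + 1), (k + α).choose (α + i + j - q) *
        (i.choose m * m.choose q * (α + j).choose (j - m)) := by
    intro m hm
    rw [Finset.mem_range] at hm
    rw [Nat.add_choose_eq_sum_range (k + α) m (α + i + j) j
      (fun q hq => Nat.choose_eq_zero_of_lt (by omega)) (by omega), Finset.mul_sum]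
    refine Finset.sum_congr rfl fun q _ => ?_
    ring
  rw [Finset.sum_congr rfl h1, Finset.sum_comm]
  have h2 : ∀ q ∈ Finset.range (j + 1),
      ∑ m ∈ Finset.range (j + 1), (k + α).choose (α + i + j - q) *
        (i.choose m * m.choose q * (α + j).choose (j - m)) =
      (k + α).choose (α + i) * (i.choose q * (k - i).choose (j - q)) := by
    intro q hq
    have hq' : q ≤ j := by simpa [Nat.lt_succ_iff] using hq
    obtain ⟨d, rfl⟩ := Nat.exists_eq_add_of_le hq'
    rw [← Finset.mul_sum, show q + d + 1 = q + (d + 1) by ring, Finset.sum_range_add,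
      Finset.sum_eq_zero (s := Finset.range q), zero_add]
    · have h3 : ∀ l ∈ Finset.range (d + 1),
          i.choose (q + l) * (q + l).choose q * (α + (q + d)).choose (q + d - (q + l)) =
          i.choose q * ((i - q).choose l * (α + (q + d)).choose (d - l)) := by
        intro l _
        rw [show q + d - (q + l) = d - l by omega]
        rw [Nat.choose_mul (show q ≤ q + l by omega), show q + l - q = l by omega]
        ring
      rw [Finset.sum_congr rfl h3, ← Finset.mul_sum, Nat.sum_choose_mul_choose_sub,
        show α + i + (q + d) - q = α + i + d by omega, show q + d - q = d by omega]
      rcases le_or_gt q i with h | h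
      · rw [show i - q + (α + (q + d)) = α + i + d by omega]
        have := Nat.choose_mul (n := k + α) (show α + i ≤ α + i + d by omega)
        rw [show α + i + d - (α + i) = d by omega, show k + α - (α + i) = k - i by omega] at this
        rw [← Nat.choose_symm_add (a := α + i) (b := d)]
        calc _ = i.choose q * ((k + α).choose (α + i + d) * (α + i + d).choose (α + i)) := by ring
          _ = _ := by rw [this]; ring
      · rw [Nat.choose_eq_zero_of_lt h]
        ring
    · intro m hm
      rw [Finset.mem_range] at hm
      rw [Nat.choose_eq_zero_of_lt hm]
      ring
  rw [Finset.sum_congr rfl h2, ← Finset.mul_sum, Nat.sum_choose_mul_choose_sub]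
  rcases le_or_gt i k with h | h
  · rw [show i + (k - i) = k by omega, mul_comm]
  · rw [Nat.choose_eq_zero_of_lt (show k + α < α + i by omega)]
    ring

/-- The sum `∑ⱼ binom(N, a + j) (-t)ʲ / j!`; for `N = k + α`, `a = α + b` it is the Laguerre
polynomial of degree `k - b` and type `α + b` (and `0` if `k < b`). -/
def laguerreSum (N a : ℕ) (t : ℂ) : ℂ :=
  ∑ j ∈ Finset.range (N + 1), ((N.choose (a + j) : ℕ) : ℂ) * ((-t) ^ j / (j.factorial : ℂ))

theorem laguerreSum_eq_sum_range {N a M : ℕ} (h : N < a + M) (t : ℂ) :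
    laguerreSum N a t =
      ∑ j ∈ Finset.range M, ((N.choose (a + j) : ℕ) : ℂ) * ((-t) ^ j / (j.factorial : ℂ)) := by
  have h1 : ∀ j, M ≤ j → N.choose (a + j) = 0 := fun j hj => Nat.choose_eq_zero_of_lt (by omega)
  have h2 : ∀ j, N + 1 ≤ j → N.choose (a + j) = 0 :=
    fun j hj => Nat.choose_eq_zero_of_lt (by omega)
  rw [laguerreSum]
  rcases le_total M (N + 1) with h' | h'
  · symm
    refine Finset.sum_subset (Finset.range_subset_range.2 h') fun x _ hx => ?_
    rw [h1 x (by simpa using hx)]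
    simp
  · refine Finset.sum_subset (Finset.range_subset_range.2 h') fun x _ hx => ?_
    rw [h2 x (by simpa using hx)]
    simp

theorem add_pow_div_factorial (x y : ℂ) (l : ℕ) :
    (x + y) ^ l / (l.factorial : ℂ) = ∑ i ∈ Finset.range (l + 1),
      x ^ i / (i.factorial : ℂ) * (y ^ (l - i) / ((l - i).factorial : ℂ)) := by
  rw [add_pow, Finset.sum_div]
  refine Finset.sum_congr rfl fun i hi => ?_
  have hi' : i ≤ l := by simpa [Nat.lt_succ_iff] using hi
  rw [Nat.cast_choose ℂ hi']
  have h1 : (l.factorial : ℂ) ≠ 0 := by exact_mod_cast l.factorial_ne_zero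
  have h2 : (i.factorial : ℂ) ≠ 0 := by exact_mod_cast i.factorial_ne_zero
  have h3 : ((l - i).factorial : ℂ) ≠ 0 := by exact_mod_cast (l - i).factorial_ne_zero
  field_simp

theorem sum_range_mul_add_pow_div_factorial {M : ℕ} (c : ℕ → ℂ) (hc : ∀ l, M ≤ l → c l = 0)
    (x y : ℂ) :
    ∑ l ∈ Finset.range M, c l * ((x + y) ^ l / (l.factorial : ℂ)) =
      ∑ i ∈ Finset.range M, ∑ j ∈ Finset.range M,
        c (i + j) * (x ^ i / (i.factorial : ℂ) * (y ^ j / (j.factorial : ℂ))) := by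
  have h1 : ∀ l ∈ Finset.range M, c l * ((x + y) ^ l / (l.factorial : ℂ)) =
      ∑ i ∈ Finset.range (l + 1), c (i + (l - i)) *
        (x ^ i / (i.factorial : ℂ) * (y ^ (l - i) / ((l - i).factorial : ℂ))) := by
    intro l _
    rw [add_pow_div_factorial, Finset.mul_sum]
    refine Finset.sum_congr rfl fun i hi => ?_
    rw [Nat.add_sub_cancel' (by simpa [Nat.lt_succ_iff] using hi)]
  rw [Finset.sum_congr rfl h1, Finset.sum_range_diag_flip M (fun i j => c (i + j) *
        (x ^ i / (i.factorial : ℂ) * (y ^ j / (j.factorial : ℂ))))]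
  refine Finset.sum_congr rfl fun i _ => ?_
  refine Finset.sum_subset (Finset.range_subset_range.2 (Nat.sub_le _ _)) fun j _ hj => ?_
  rw [hc _ (by simp at hj; omega), zero_mul]

theorem laguerreSum_sub {N a M : ℕ} (h : N < a + M) (s v : ℂ) :
    laguerreSum N a (s - v) = ∑ b ∈ Finset.range M,
      v ^ b / (b.factorial : ℂ) * laguerreSum N (a + b) s := by
  rw [laguerreSum_eq_sum_range h, show -(s - v) = v + -s by ring,
    sum_range_mul_add_pow_div_factorial (fun l => ((N.choose (a + l) : ℕ) : ℂ))
      (fun l hl => by simp [Nat.choose_eq_zero_of_lt (show N < a + l by omega)])]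
  refine Finset.sum_congr rfl fun b _ => ?_
  rw [laguerreSum_eq_sum_range (M := M) (by omega), Finset.mul_sum]
  refine Finset.sum_congr rfl fun j _ => ?_
  rw [add_assoc]
  ring

theorem sum_choose_mul_laguerreSum (N a b : ℕ) (s : ℂ) :
    ∑ c ∈ Finset.range (b + 1), ((b.choose c : ℕ) : ℂ) * laguerreSum N (a + b + c) s =
      laguerreSum (N + b) (a + 2 * b) s := by
  rw [laguerreSum_eq_sum_range (M := N + 1) (by omega)]
  simp only [laguerreSum, Finset.mul_sum]
  rw [Finset.sum_comm]
  refine Finset.sum_congr rfl fun j _ => ?_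
  rw [Nat.add_choose_eq_sum_range N b (a + 2 * b + j) b
    (fun q hq => Nat.choose_eq_zero_of_lt hq) (by omega), ← Finset.sum_range_reflect,
    Nat.cast_sum, Finset.sum_mul]
  refine Finset.sum_congr rfl fun c hc => ?_
  have hc' : c ≤ b := by simpa [Nat.lt_succ_iff] using hc
  rw [show b + 1 - 1 - c = b - c by omega, Nat.choose_symm hc',
    show a + b + (b - c) + j = a + 2 * b + j - c by omega]
  push_cast
  ring

theorem sum_range_add_eq_sum_range_ite {M : ℕ} (m : ℕ) (h : ℕ → ℂ)
    (hh : ∀ i, M ≤ i → m ≤ i → h i = 0) :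
    ∑ i ∈ Finset.range M, h (i + m) = ∑ i ∈ Finset.range M, if m ≤ i then h i else 0 := by
  have h1 : ∑ i ∈ Finset.range (m + M), (if m ≤ i then h i else 0) =
      ∑ i ∈ Finset.range M, h (i + m) := by
    rw [Finset.sum_range_add, Finset.sum_eq_zero, zero_add]
    · simp [add_comm m]
    · intro i hi
      rw [if_neg (by simpa using hi)]
  rw [← h1]
  symm
  refine Finset.sum_subset (Finset.range_subset_range.2 (by omega)) fun i _ hi => ?_
  split_ifs with h'
  · exact hh i (by simpa using hi) h'
  · rfl

theorem laguerreSum_mul_laguerreSum_aux (α k m : ℕ) (x y : ℂ) :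
    (x * y) ^ m * ((α.factorial : ℂ) / (m.factorial * (α + m).factorial)) *
        laguerreSum (k + α + m) (α + 2 * m) (x + y) =
      ∑ i ∈ Finset.range (k + 1), ∑ j ∈ Finset.range (k + 1),
        ((if m ≤ j then (i.choose m * (α + j).choose (j - m) *
          (k + α + m).choose (α + i + j) : ℕ) else 0 : ℕ) : ℂ) *
          ((α.factorial : ℂ) / (i.factorial * (α + j).factorial) * ((-x) ^ i * (-y) ^ j)) := by
  have hf : ∀ l : ℕ, (l.factorial : ℂ) ≠ 0 := fun l => by exact_mod_cast l.factorial_ne_zero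
  set H : ℕ → ℕ → ℂ := fun i j => (i.choose m * (α + j).choose (j - m) *
          (k + α + m).choose (α + i + j) : ℕ) *
          ((α.factorial : ℂ) / (i.factorial * (α + j).factorial) * ((-x) ^ i * (-y) ^ j)) with hH
  have hH0 : ∀ i j, k + 1 + m ≤ i + j → H i j = 0 := by
    intro i j hij
    simp only [hH]
    rw [Nat.choose_eq_zero_of_lt (show k + α + m < α + i + j by omega)]
    simp
  have h1 : ∑ i ∈ Finset.range (k + 1), ∑ j ∈ Finset.range (k + 1), H (i + m) (j + m) =
      ∑ i ∈ Finset.range (k + 1), ∑ j ∈ Finset.range (k + 1), if m ≤ j then H i j else 0 := by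
    rw [sum_range_add_eq_sum_range_ite m
      (fun i => ∑ j ∈ Finset.range (k + 1), H i (j + m))
      (fun i hi _ => Finset.sum_eq_zero fun j _ => hH0 _ _ (by omega))]
    refine Finset.sum_congr rfl fun i _ => ?_
    split_ifs with him
    · exact sum_range_add_eq_sum_range_ite m (fun j => H i j)
        (fun j hj _ => hH0 _ _ (by omega))
    · symm
      refine Finset.sum_eq_zero fun j _ => ?_
      simp only [hH]
      rw [Nat.choose_eq_zero_of_lt (show i < m by omega)]
      simp
  trans ∑ i ∈ Finset.range (k + 1), ∑ j ∈ Finset.range (k + 1), H (i + m) (j + m)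
  · rw [laguerreSum_eq_sum_range (M := k + 1) (by omega), neg_add,
      sum_range_mul_add_pow_div_factorial
        (fun l => (((k + α + m).choose (α + 2 * m + l) : ℕ) : ℂ))
        (fun l hl => by
          simp [Nat.choose_eq_zero_of_lt (show k + α + m < α + 2 * m + l by omega)])]
    simp only [Finset.mul_sum]
    refine Finset.sum_congr rfl fun i _ => Finset.sum_congr rfl fun j _ => ?_
    simp only [hH]
    rw [show α + (i + m) + (j + m) = α + 2 * m + (i + j) by ring, Nat.add_sub_cancel]
    push_cast
    rw [Nat.cast_choose ℂ (show m ≤ i + m by omega), Nat.add_sub_cancel,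
      Nat.cast_choose ℂ (show j ≤ α + (j + m) by omega),
      show α + (j + m) - j = α + m by omega]
    have := hf m
    have := hf i
    have := hf j
    have := hf (i + m)
    have := hf (α + m)
    have := hf (α + (j + m))
    field_simp
    rw [pow_add, pow_add, show (x * y) ^ m = (-x) ^ m * (-y) ^ m by rw [← mul_pow]; ring]
    ring
  · rw [h1]
    refine Finset.sum_congr rfl fun i _ => Finset.sum_congr rfl fun j _ => ?_
    split_ifs <;> simp [hH]

/-- The product formula for Laguerre polynomials of type `α` and degree `k`. -/
theorem sum_laguerreSum_eq_mul (α k : ℕ) (x y : ℂ) :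
    ∑ m ∈ Finset.range (k + 1),
      (x * y) ^ m * ((α.factorial : ℂ) / (m.factorial * (α + m).factorial)) *
        laguerreSum (k + α + m) (α + 2 * m) (x + y) =
      (k.factorial : ℂ) * α.factorial / (k + α).factorial *
        (laguerreSum (k + α) α x * laguerreSum (k + α) α y) := by
  have hf : ∀ l : ℕ, (l.factorial : ℂ) ≠ 0 := fun l => by exact_mod_cast l.factorial_ne_zero
  rw [Finset.sum_congr rfl fun m _ => laguerreSum_mul_laguerreSum_aux α k m x y,
    Finset.sum_comm, laguerreSum_eq_sum_range (M := k + 1) (by omega),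
    laguerreSum_eq_sum_range (M := k + 1) (by omega), Finset.sum_mul_sum, Finset.mul_sum]
  refine Finset.sum_congr rfl fun i _ => ?_
  rw [Finset.sum_comm, Finset.mul_sum]
  refine Finset.sum_congr rfl fun j hj => ?_
  have hjk : j ≤ k := by simpa [Nat.lt_succ_iff] using hj
  rw [← Finset.sum_mul, ← Nat.cast_sum, ← Finset.sum_filter,
    show (Finset.range (k + 1)).filter (fun m => m ≤ j) = Finset.range (j + 1) by
      ext m; simp only [Finset.mem_filter, Finset.mem_range]; omega,
    Nat.sum_choose_mul_choose_mul_choose, Nat.cast_mul, Nat.cast_choose ℂ hjk,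
    Nat.cast_choose ℂ (show α + j ≤ k + α by omega), show k + α - (α + j) = k - j by omega]
  have := hf i
  have := hf j
  have := hf (α + j)
  have := hf (k + α)
  have := hf (k - j)
  field_simp

theorem measurePreserving_unitary {n : ℕ} (U : Cn n ≃ₗᵢ[ℂ] Cn n) :
    MeasurePreserving U (volume : Measure (Cn n)) volume :=
  LinearIsometryEquiv.measurePreserving
    (⟨U.toLinearEquiv.restrictScalars ℝ, U.norm_map⟩ : Cn n ≃ₗᵢ[ℝ] Cn n)

theorem integral_comp_unitary {n : ℕ} {E : Type*} [NormedAddCommGroup E] [NormedSpace ℝ E]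
    (U : Cn n ≃ₗᵢ[ℂ] Cn n) (h : Cn n → E) : ∫ w, h (U w) = ∫ w, h w :=
  (measurePreserving_unitary U).integral_comp U.toHomeomorph.measurableEmbedding h

/-- Scalar multiplication by a unit complex number, as a unitary map. -/
def unitScalar (n : ℕ) (c : ℂ) (hc : ‖c‖ = 1) : Cn n ≃ₗᵢ[ℂ] Cn n where
  toLinearEquiv := LinearEquiv.smulOfNeZero ℂ (Cn n) c (by
    rintro rfl
    simp at hc)
  norm_map' w := by
    rw [LinearEquiv.smulOfNeZero_apply, norm_smul, hc, one_mul]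

@[simp]
theorem unitScalar_apply (n : ℕ) (c : ℂ) (hc : ‖c‖ = 1) (w : Cn n) :
    unitScalar n c hc w = c • w := rfl

theorem exists_unitary_map_single (α : ℕ) (z : Cn (α + 1)) :
    ∃ U : Cn (α + 1) ≃ₗᵢ[ℂ] Cn (α + 1), z = (‖z‖ : ℂ) • U (EuclideanSpace.single 0 1) := by
  rcases eq_or_ne z 0 with rfl | hz
  · exact ⟨LinearIsometryEquiv.refl ℂ _, by simp⟩
  have hz' : ‖z‖ ≠ 0 := norm_ne_zero_iff.2 hz
  let v : Fin (α + 1) → Cn (α + 1) := fun _ => ((‖z‖ : ℂ)⁻¹) • z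
  have hv : Orthonormal ℂ (({0} : Set (Fin (α + 1))).domRestrict v) := by
    refine ⟨fun i => ?_, fun i j hij => (hij (Subsingleton.elim _ _)).elim⟩
    simp [v, norm_smul, hz']
  obtain ⟨b, hb⟩ := hv.exists_orthonormalBasis_extension_of_card_eq (by simp)
  refine ⟨b.repr.symm, ?_⟩
  rw [b.repr_symm_single, hb 0 rfl]
  simp only [v]
  rw [smul_inv_smul₀]
  exact_mod_cast hz'

/-- The moments of a radial function along a phase vanish off the diagonal. -/
theorem integral_radial_mul_inner_pow_eq_zero {n : ℕ} {h : Cn n → ℂ}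
    (hh : ∀ (U : Cn n ≃ₗᵢ[ℂ] Cn n) w, h (U w) = h w) (z : Cn n) {a b : ℕ} (hab : a ≠ b) :
    ∫ w, h w * (inner ℂ z w ^ a * (starRingEnd ℂ) (inner ℂ z w) ^ b) = 0 := by
  set c : ℂ := Complex.exp ((π / ((a : ℝ) - b) : ℝ) * Complex.I) with hc
  have hc1 : ‖c‖ = 1 := Complex.norm_exp_ofReal_mul_I _
  have hab' : (a : ℂ) - b ≠ 0 := sub_ne_zero.2 (by exact_mod_cast hab)
  have hcab : c ^ a * (starRingEnd ℂ) c ^ b = -1 := by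
    rw [hc, ← Complex.exp_conj, ← Complex.exp_nat_mul, ← Complex.exp_nat_mul, ← Complex.exp_add,
      ← Complex.exp_pi_mul_I]
    congr 1
    simp only [map_mul, Complex.conj_ofReal, Complex.conj_I]
    push_cast
    field_simp
    ring
  have key := integral_comp_unitary (unitScalar n c hc1)
    (fun w => h w * (inner ℂ z w ^ a * (starRingEnd ℂ) (inner ℂ z w) ^ b))
  have h2 : ∀ w, h (unitScalar n c hc1 w) * (inner ℂ z (unitScalar n c hc1 w) ^ a *
      (starRingEnd ℂ) (inner ℂ z (unitScalar n c hc1 w)) ^ b) =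
      -(h w * (inner ℂ z w ^ a * (starRingEnd ℂ) (inner ℂ z w) ^ b)) := by
    intro w
    rw [hh, unitScalar_apply, inner_smul_right, map_mul, mul_pow, mul_pow]
    linear_combination (h w * (inner ℂ z w ^ a * (starRingEnd ℂ) (inner ℂ z w) ^ b)) * hcab
  simp only [h2, integral_neg] at key
  exact self_eq_neg.1 key.symm

theorem integral_radial_mul_norm_inner_pow {α : ℕ} {h : Cn (α + 1) → ℂ}
    (hh : ∀ (U : Cn (α + 1) ≃ₗᵢ[ℂ] Cn (α + 1)) w, h (U w) = h w) (z : Cn (α + 1)) (m : ℕ) :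
    ∫ w, h w * ((‖(inner ℂ z w : ℂ)‖ ^ m : ℝ) : ℂ) =
      ((‖z‖ ^ m : ℝ) : ℂ) * ∫ w, h w * ((‖w 0‖ ^ m : ℝ) : ℂ) := by
  obtain ⟨U, hU⟩ := exists_unitary_map_single α z
  rw [← integral_comp_unitary U, ← integral_const_mul]
  congr 1
  ext w
  have h1 : ‖(inner ℂ z (U w) : ℂ)‖ = ‖z‖ * ‖w 0‖ := by
    conv_lhs => rw [hU]
    rw [inner_smul_left, U.inner_map_map, EuclideanSpace.inner_single_left]
    simp
  rw [hh, h1, mul_pow]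
  push_cast
  ring

theorem integral_norm_coord_pow_gaussian (α : ℕ) : ∃ C : ℝ, 0 < C ∧ ∀ m : ℕ,
    ∫ z : Cn (α + 1), ‖z 0‖ ^ (2 * m) * Real.exp (-‖z‖ ^ 2) = C * m.factorial := by
  let L := PiLp.continuousLinearEquiv 2 ℂ (fun _ : Fin (α + 1) => ℂ)
  have : (Measure.map L (volume : Measure (Cn (α + 1)))).IsAddHaarMeasure :=
    L.isAddHaarMeasure_map volume
  have hmap := Measure.isAddLeftInvariant_eq_smul (Measure.map L (volume : Measure (Cn (α + 1))))
    (volume : Measure (Fin (α + 1) → ℂ))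
  set c := (Measure.map L (volume : Measure (Cn (α + 1)))).addHaarScalarFactor
    (volume : Measure (Fin (α + 1) → ℂ)) with hc
  have hc0 : 0 < c := Measure.addHaarScalarFactor_pos_of_isAddHaarMeasure _ _
  have hgauss : ∀ m : ℕ, ∫ x : ℂ, ‖x‖ ^ (2 * m) * Real.exp (-‖x‖ ^ 2) = π * m.factorial := by
    intro m
    have := Complex.integral_rpow_mul_exp_neg_rpow (p := 2) (q := (2 * m : ℕ)) (by norm_num)
      (by have : (0 : ℝ) ≤ (2 * m : ℕ) := by positivity
          linarith)
    rw [show (((2 * m : ℕ) : ℝ) + 2) / 2 = m + 1 by push_cast; ring, Real.Gamma_nat_eq_factorial]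
      at this
    simp only [Real.rpow_natCast, Real.rpow_ofNat] at this
    rw [this]
    ring
  refine ⟨c * (π * π ^ α), by positivity, fun m => ?_⟩
  calc ∫ z : Cn (α + 1), ‖z 0‖ ^ (2 * m) * Real.exp (-‖z‖ ^ 2)
      = ∫ z : Cn (α + 1), ∏ i, ‖L z i‖ ^ (2 * (if i = 0 then m else 0)) *
          Real.exp (-‖L z i‖ ^ 2) := by
        congr 1
        ext z
        rw [Finset.prod_mul_distrib, ← Real.exp_sum, EuclideanSpace.norm_sq_eq,
          Finset.sum_neg_distrib]
        congr 1
        simp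
        rfl
    _ = ∫ x : Fin (α + 1) → ℂ, ∏ i, ‖x i‖ ^ (2 * (if i = 0 then m else 0)) *
          Real.exp (-‖x i‖ ^ 2) ∂(Measure.map L (volume : Measure (Cn (α + 1)))) :=
        (L.toHomeomorph.measurableEmbedding.integral_map (fun x : Fin (α + 1) → ℂ =>
          ∏ i, ‖x i‖ ^ (2 * (if i = 0 then m else 0)) * Real.exp (-‖x i‖ ^ 2))).symm
    _ = c * (π * π ^ α) * m.factorial := by
        rw [hmap, integral_smul_nnreal_measure, integral_fintype_prod_volume_eq_prod
          (fun i (x : ℂ) => ‖x‖ ^ (2 * (if i = 0 then m else 0)) * Real.exp (-‖x‖ ^ 2))]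
        simp only [hgauss, Fin.prod_univ_succ]
        simp [NNReal.smul_def]
        ring

theorem integral_norm_pow_gaussian (α : ℕ) : ∃ C : ℝ, ∀ m : ℕ,
    ∫ z : Cn (α + 1), ‖z‖ ^ (2 * m) * Real.exp (-‖z‖ ^ 2) = C * (α + m).factorial := by
  refine ⟨Module.finrank ℝ (Cn (α + 1)) * (volume : Measure (Cn (α + 1))).real (Metric.ball 0 1) *
    (1 / 2), fun m => ?_⟩
  have h := integral_fun_norm_addHaar (volume : Measure (Cn (α + 1)))
    (fun r => r ^ (2 * m) * Real.exp (-r ^ 2))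
  have hfin : Module.finrank ℝ (Cn (α + 1)) = 2 * (α + 1) := by
    rw [finrank_real_of_complex]
    simp
  have h2 := _root_.integral_rpow_mul_exp_neg_rpow (p := 2) (q := (2 * (α + m) + 1 : ℕ))
    (by norm_num) (by
      have : (0 : ℝ) ≤ (2 * (α + m) + 1 : ℕ) := by positivity
      linarith)
  rw [show (((2 * (α + m) + 1 : ℕ) : ℝ) + 1) / 2 = (α + m : ℕ) + 1 by push_cast; ring,
    Real.Gamma_nat_eq_factorial] at h2
  simp only [Real.rpow_natCast, Real.rpow_ofNat] at h2
  rw [h, mul_assoc, mul_assoc, ← h2, nsmul_eq_mul, smul_eq_mul, hfin]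
  congr 3
  ext r
  rw [smul_eq_mul, ← mul_assoc, ← pow_add]
  congr 2
  omega

theorem integral_norm_pow_gaussian_eq (α : ℕ) : ∃ C : ℝ, 0 < C ∧ ∀ m : ℕ,
    (∫ z : Cn (α + 1), ‖z 0‖ ^ (2 * m) * Real.exp (-‖z‖ ^ 2) = C * m.factorial) ∧
    ∫ z : Cn (α + 1), ‖z‖ ^ (2 * m) * Real.exp (-‖z‖ ^ 2) =
      C * ((α + m).factorial / α.factorial) := by
  obtain ⟨C, hC, h1⟩ := integral_norm_coord_pow_gaussian α
  obtain ⟨D, h2⟩ := integral_norm_pow_gaussian α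
  have h := (h1 0).symm.trans (by simpa using h2 0)
  refine ⟨C, hC, fun m => ⟨h1 m, ?_⟩⟩
  rw [h2]
  have := α.factorial_pos
  field_simp
  simp at h
  rw [h]

/-- The average of `|⟨z, w⟩|²ᵐ` against a radial function of `w`. -/
theorem integral_radial_mul_norm_inner_pow_eq {α : ℕ} {h : Cn (α + 1) → ℂ}
    (hh : ∀ (U : Cn (α + 1) ≃ₗᵢ[ℂ] Cn (α + 1)) w, h (U w) = h w)
    (hm : AEStronglyMeasurable h volume) (z : Cn (α + 1)) (m : ℕ)
    (hi : Integrable (fun w => h w * ((‖w‖ ^ (2 * m) : ℝ) : ℂ))) :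
    ∫ w, h w * ((‖(inner ℂ z w : ℂ)‖ ^ (2 * m) : ℝ) : ℂ) =
      ((‖z‖ ^ (2 * m) : ℝ) : ℂ) * ((m.factorial * α.factorial : ℂ) / (α + m).factorial) *
        ∫ w, h w * ((‖w‖ ^ (2 * m) : ℝ) : ℂ) := by
  obtain ⟨C, hC, hgauss⟩ := integral_norm_pow_gaussian_eq α
  obtain ⟨hA, hN⟩ := hgauss m
  have hint : Integrable (fun z : Cn (α + 1) => ‖z‖ ^ (2 * m) * Real.exp (-‖z‖ ^ 2)) := by
    refine not_imp_comm.1 integral_undef ?_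
    rw [hN]
    positivity
  have hE : ∀ (U : Cn (α + 1) ≃ₗᵢ[ℂ] Cn (α + 1)) w,
      (fun w => ((Real.exp (-‖w‖ ^ 2) : ℝ) : ℂ)) (U w) =
        (fun w => ((Real.exp (-‖w‖ ^ 2) : ℝ) : ℂ)) w := fun U w => by simp
  have hΦ : Integrable (Function.uncurry fun z w : Cn (α + 1) =>
      ((Real.exp (-‖z‖ ^ 2) : ℝ) : ℂ) *
        (h w * ((‖(inner ℂ z w : ℂ)‖ ^ (2 * m) : ℝ) : ℂ))) (volume.prod volume) := by
    refine (hint.mul_prod hi.norm).mono' ?_ (Eventually.of_forall fun p => ?_)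
    · refine AEStronglyMeasurable.mul ?_ (hm.comp_snd.mul ?_)
      · exact Continuous.aestronglyMeasurable (by fun_prop)
      · exact Continuous.aestronglyMeasurable (by fun_prop)
    · simp only [Function.uncurry, norm_mul, Complex.norm_real, norm_pow, Real.norm_eq_abs,
        Real.abs_exp, abs_norm]
      have h1 : ‖(inner ℂ p.1 p.2 : ℂ)‖ ^ (2 * m) ≤ ‖p.1‖ ^ (2 * m) * ‖p.2‖ ^ (2 * m) := by
        rw [← mul_pow]
        gcongr
        exact norm_inner_le_norm _ _
      calc _ = (Real.exp (-‖p.1‖ ^ 2) * ‖h p.2‖) * ‖(inner ℂ p.1 p.2 : ℂ)‖ ^ (2 * m) := by ring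
        _ ≤ (Real.exp (-‖p.1‖ ^ 2) * ‖h p.2‖) * (‖p.1‖ ^ (2 * m) * ‖p.2‖ ^ (2 * m)) := by gcongr
        _ = _ := by ring
  have hswap := integral_integral_swap hΦ
  have hleft : ∫ z : Cn (α + 1), ∫ w : Cn (α + 1), ((Real.exp (-‖z‖ ^ 2) : ℝ) : ℂ) *
        (h w * ((‖(inner ℂ z w : ℂ)‖ ^ (2 * m) : ℝ) : ℂ)) =
      ((C * ((α + m).factorial / α.factorial) : ℝ) : ℂ) *
        ∫ w, h w * ((‖w 0‖ ^ (2 * m) : ℝ) : ℂ) := by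
    rw [← hN, ← integral_complex_ofReal, ← integral_mul_const]
    congr 1
    ext z
    rw [integral_const_mul, integral_radial_mul_norm_inner_pow hh]
    push_cast
    ring
  have hright : ∫ w : Cn (α + 1), ∫ z : Cn (α + 1), ((Real.exp (-‖z‖ ^ 2) : ℝ) : ℂ) *
        (h w * ((‖(inner ℂ z w : ℂ)‖ ^ (2 * m) : ℝ) : ℂ)) =
      ((C * m.factorial : ℝ) : ℂ) * ∫ w, h w * ((‖w‖ ^ (2 * m) : ℝ) : ℂ) := by
    rw [← hA, ← integral_complex_ofReal, ← integral_const_mul]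
    congr 1
    ext w
    have h1 : ∀ z : Cn (α + 1), ((Real.exp (-‖z‖ ^ 2) : ℝ) : ℂ) *
        (h w * ((‖(inner ℂ z w : ℂ)‖ ^ (2 * m) : ℝ) : ℂ)) =
        h w * (((Real.exp (-‖z‖ ^ 2) : ℝ) : ℂ) * ((‖(inner ℂ w z : ℂ)‖ ^ (2 * m) : ℝ) : ℂ)) := by
      intro z
      rw [norm_inner_symm]
      ring
    simp only [h1]
    rw [integral_const_mul, integral_radial_mul_norm_inner_pow hE w]
    simp only [Complex.ofReal_mul, mul_comm]
    ring
  rw [hleft, hright] at hswap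
  rw [integral_radial_mul_norm_inner_pow hh]
  have hC' : (C : ℂ) ≠ 0 := by exact_mod_cast hC.ne'
  have h1 : (α.factorial : ℂ) ≠ 0 := by exact_mod_cast α.factorial_ne_zero
  have h2 : ((α + m).factorial : ℂ) ≠ 0 := by exact_mod_cast (α + m).factorial_ne_zero
  push_cast at hswap ⊢
  rw [mul_assoc]
  congr 1
  field_simp at hswap ⊢
  linear_combination hswap

/-- Continuous functions of at most exponential growth. -/
structure ExpGrowth {n : ℕ} (P : Cn n → ℂ) : Prop where
  continuous : Continuous P
  bound : ∃ K r : ℝ, ∀ w, ‖P w‖ ≤ K * Real.exp (r * ‖w‖)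

namespace ExpGrowth

variable {n : ℕ} {P Q : Cn n → ℂ}

theorem const (c : ℂ) : ExpGrowth (fun _ : Cn n => c) :=
  ⟨continuous_const, ‖c‖, 0, fun w => by simp⟩

theorem mul (hP : ExpGrowth P) (hQ : ExpGrowth Q) : ExpGrowth (fun w => P w * Q w) := by
  obtain ⟨K, r, h⟩ := hP.bound
  obtain ⟨L, s, h'⟩ := hQ.bound
  refine ⟨hP.continuous.mul hQ.continuous, K * L, r + s, fun w => ?_⟩
  rw [norm_mul, add_mul, Real.exp_add]
  calc ‖P w‖ * ‖Q w‖ ≤ (K * Real.exp (r * ‖w‖)) * (L * Real.exp (s * ‖w‖)) :=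
        mul_le_mul (h w) (h' w) (norm_nonneg _) ((norm_nonneg _).trans (h w))
    _ = _ := by ring

theorem add (hP : ExpGrowth P) (hQ : ExpGrowth Q) : ExpGrowth (fun w => P w + Q w) := by
  obtain ⟨K, r, h⟩ := hP.bound
  obtain ⟨L, s, h'⟩ := hQ.bound
  refine ⟨hP.continuous.add hQ.continuous, |K| + |L|, max r s, fun w => ?_⟩
  calc ‖P w + Q w‖ ≤ K * Real.exp (r * ‖w‖) + L * Real.exp (s * ‖w‖) :=
        (norm_add_le _ _).trans (add_le_add (h w) (h' w))
    _ ≤ |K| * Real.exp (max r s * ‖w‖) + |L| * Real.exp (max r s * ‖w‖) := by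
        gcongr
        · exact le_abs_self K
        · exact le_max_left r s
        · exact le_abs_self L
        · exact le_max_right r s
    _ = _ := by ring

theorem sum {ι : Type*} (s : Finset ι) {P : ι → Cn n → ℂ} (h : ∀ i ∈ s, ExpGrowth (P i)) :
    ExpGrowth (fun w => ∑ i ∈ s, P i w) := by
  classical
  induction s using Finset.induction_on with
  | empty => simpa using const 0
  | insert i s hi ih =>
    simp only [Finset.sum_insert hi]
    exact (h i (Finset.mem_insert_self i s)).add
      (ih fun j hj => h j (Finset.mem_insert_of_mem hj))

theorem pow (hP : ExpGrowth P) (m : ℕ) : ExpGrowth (fun w => P w ^ m) := by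
  induction m with
  | zero => simpa using const 1
  | succ m ih => simpa only [pow_succ] using ih.mul hP

theorem ofReal_norm : ExpGrowth (fun w : Cn n => (‖w‖ : ℂ)) :=
  ⟨by fun_prop, 1, 1, fun w => by
    rw [Complex.norm_real, norm_norm, one_mul, one_mul]
    linarith [Real.add_one_le_exp ‖w‖]⟩

theorem laguerreSum (N a : ℕ) (hP : ExpGrowth P) :
    ExpGrowth (fun w => laguerreSum N a (P w)) := by
  refine ExpGrowth.sum _ fun j _ => (const _).mul ?_
  simpa only [div_eq_mul_inv, neg_one_mul] using ((((const (-1)).mul hP).pow j).mul (const _))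

theorem of_norm_le (hP : Continuous P) (c : ℝ) (h : ∀ w, ‖P w‖ ≤ c * ‖w‖) : ExpGrowth P := by
  refine ⟨hP, |c|, 1, fun w => (h w).trans ?_⟩
  gcongr
  · exact le_abs_self c
  · rw [one_mul]
    linarith [Real.add_one_le_exp ‖w‖]

theorem exp_of_norm_le (hP : Continuous P) (c : ℝ) (h : ∀ w, ‖P w‖ ≤ c * ‖w‖) :
    ExpGrowth (fun w => Complex.exp (P w)) := by
  refine ⟨by fun_prop, 1, c, fun w => ?_⟩
  rw [one_mul]
  exact (Complex.norm_exp_le_exp_norm _).trans (Real.exp_le_exp.2 (h w))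

theorem integrable {G : Cn n → ℂ} (hG : Integrable G) {A : ℝ} (hA : 0 < A) (hP : ExpGrowth P) :
    Integrable (fun w => G w * ((Real.exp (-(A * ‖w‖ ^ 2 / 2)) : ℝ) : ℂ) * P w) := by
  obtain ⟨K, r, h⟩ := hP.bound
  have hc := hP.continuous
  simp only [mul_assoc]
  refine hG.mul_bdd (c := |K| * Real.exp (r ^ 2 / (2 * A)))
    (Continuous.aestronglyMeasurable (by fun_prop)) (Eventually.of_forall fun w => ?_)
  rw [norm_mul, Complex.norm_real, Real.norm_eq_abs, Real.abs_exp]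
  calc Real.exp (-(A * ‖w‖ ^ 2 / 2)) * ‖P w‖
      ≤ Real.exp (-(A * ‖w‖ ^ 2 / 2)) * (|K| * Real.exp (r * ‖w‖)) := by
        gcongr
        exact (h w).trans (by gcongr; exact le_abs_self K)
    _ = |K| * Real.exp (-(A * ‖w‖ ^ 2 / 2) + r * ‖w‖) := by
        rw [Real.exp_add]
        ring
    _ ≤ _ := by
        gcongr
        rw [le_div_iff₀ (by positivity)]
        nlinarith [sq_nonneg (A * ‖w‖ - r)]

end ExpGrowth

theorem integral_mul_conj_pow_mul_pow_mul_exp {n : ℕ} {h u : Cn n → ℂ}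
    (hm : AEStronglyMeasurable h volume) (hu : Continuous u)
    (hvan : ∀ b d : ℕ, b ≠ d → ∫ w, h w * ((starRingEnd ℂ) (u w) ^ b * u w ^ d) = 0) (b c : ℕ)
    (hint : Integrable (fun w => h w * ((starRingEnd ℂ) (u w) ^ b * u w ^ c) *
      Complex.exp (‖u w‖ : ℂ))) :
    ∫ w, h w * ((starRingEnd ℂ) (u w) ^ b * u w ^ c) * Complex.exp (u w) =
      if c ≤ b then ((b - c).factorial : ℂ)⁻¹ * ∫ w, h w * ((‖u w‖ ^ (2 * b) : ℝ) : ℂ) else 0 := by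
  have hconj : Continuous fun w => (starRingEnd ℂ) (u w) := Complex.continuous_conj.comp hu
  have hs := hasSum_integral_of_dominated_convergence (μ := (volume : Measure (Cn n)))
    (F := fun (m : ℕ) w => h w * ((starRingEnd ℂ) (u w) ^ b * u w ^ c) *
      (u w ^ m / (m.factorial : ℂ)))
    (f := fun w => h w * ((starRingEnd ℂ) (u w) ^ b * u w ^ c) * Complex.exp (u w))
    (fun m w => ‖h w * ((starRingEnd ℂ) (u w) ^ b * u w ^ c)‖ * (‖u w‖ ^ m / m.factorial))
    (fun m => (hm.mul (Continuous.aestronglyMeasurable (by fun_prop))).mul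
      (Continuous.aestronglyMeasurable (by fun_prop)))
    (fun m => Eventually.of_forall fun w => by
      rw [norm_mul, norm_div, norm_pow, Complex.norm_natCast])
    (Eventually.of_forall fun w => (Real.summable_pow_div_factorial _).mul_left _)
    (by
      refine hint.norm.congr (Eventually.of_forall fun w => ?_)
      simp only
      rw [tsum_mul_left, norm_mul, ← Complex.ofReal_exp, Complex.norm_real, Real.norm_eq_abs,
        Real.abs_exp, Real.exp_eq_exp_ℝ, NormedSpace.exp_eq_tsum_div])
    (Eventually.of_forall fun w => by
      rw [Complex.exp_eq_exp_ℂ, NormedSpace.exp_eq_tsum_div]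
      exact ((NormedSpace.expSeries_div_summable (u w)).hasSum).mul_left _)
  have hterm : ∀ m : ℕ, ∫ w, h w * ((starRingEnd ℂ) (u w) ^ b * u w ^ c) *
      (u w ^ m / (m.factorial : ℂ)) =
      (m.factorial : ℂ)⁻¹ * ∫ w, h w * ((starRingEnd ℂ) (u w) ^ b * u w ^ (c + m)) := by
    intro m
    rw [← integral_const_mul]
    congr 1
    ext w
    ring
  simp only [hterm] at hs
  split_ifs with hcb
  · refine hs.unique ?_
    have := hasSum_single (f := fun m : ℕ => (m.factorial : ℂ)⁻¹ *
      ∫ w, h w * ((starRingEnd ℂ) (u w) ^ b * u w ^ (c + m))) (b - c)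
      (fun m hm => by rw [hvan _ _ (by omega), mul_zero])
    have hsq : ∀ w, (starRingEnd ℂ) (u w) ^ b * u w ^ (c + (b - c)) =
        ((‖u w‖ ^ (2 * b) : ℝ) : ℂ) := fun w => by
      rw [Nat.add_sub_cancel' hcb, ← mul_pow, mul_comm, Complex.mul_conj,
        Complex.normSq_eq_norm_sq, ← Complex.ofReal_pow, pow_mul]
    simpa only [hsq] using this
  · refine hs.unique ?_
    convert hasSum_zero using 2 with m
    rw [hvan _ _ (by omega), mul_zero]

theorem integral_radial_mul_laguerreSum_mul_exp {α : ℕ} (k : ℕ) {G : Cn (α + 1) → ℂ}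
    (hG : Integrable G) (hrad : ∀ (U : Cn (α + 1) ≃ₗᵢ[ℂ] Cn (α + 1)) w, G (U w) = G w)
    {A : ℝ} (hA : 0 < A) (z : Cn (α + 1)) {u : Cn (α + 1) → ℂ}
    (hu : (∀ w, u w = A * inner ℂ z w) ∨ (∀ w, u w = A * (starRingEnd ℂ) (inner ℂ z w))) :
    ∫ w, G w * ((Real.exp (-(A * ‖w‖ ^ 2 / 2)) : ℝ) : ℂ) *
        (laguerreSum (k + α) α (((A * ‖z‖ ^ 2 : ℝ) : ℂ) + ((A * ‖w‖ ^ 2 : ℝ) : ℂ) - u w -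
          (starRingEnd ℂ) (u w)) * Complex.exp (u w)) =
      (k.factorial : ℂ) * α.factorial / (k + α).factorial *
        (laguerreSum (k + α) α ((A * ‖z‖ ^ 2 : ℝ) : ℂ) *
          ∫ w, G w * ((Real.exp (-(A * ‖w‖ ^ 2 / 2)) : ℝ) : ℂ) *
            laguerreSum (k + α) α ((A * ‖w‖ ^ 2 : ℝ) : ℂ)) := by
  have hf : ∀ l : ℕ, (l.factorial : ℂ) ≠ 0 := fun l => by exact_mod_cast l.factorial_ne_zero
  set x : ℂ := ((A * ‖z‖ ^ 2 : ℝ) : ℂ) with hx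
  set y : Cn (α + 1) → ℂ := fun w => ((A * ‖w‖ ^ 2 : ℝ) : ℂ) with hy
  set g : Cn (α + 1) → ℂ := fun w => G w * ((Real.exp (-(A * ‖w‖ ^ 2 / 2)) : ℝ) : ℂ) with hg
  set H : ℕ → Cn (α + 1) → ℂ := fun d w => g w * laguerreSum (k + α) (α + d) (x + y w) with hH
  have hgU : ∀ (U : Cn (α + 1) ≃ₗᵢ[ℂ] Cn (α + 1)) w, g (U w) = g w := fun U w => by
    simp only [hg, hrad, U.norm_map]
  have hHU : ∀ d (U : Cn (α + 1) ≃ₗᵢ[ℂ] Cn (α + 1)) w, H d (U w) = H d w := fun d U w => by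
    simp only [hH, hgU, hy, U.norm_map]
  have hucont : Continuous u := by
    rcases hu with hu | hu
    · rw [funext hu]
      fun_prop
    · rw [funext hu]
      exact continuous_const.mul (Complex.continuous_conj.comp (by fun_prop))
  have hunorm : ∀ w, ‖u w‖ = A * ‖(inner ℂ z w : ℂ)‖ := by
    intro w
    rcases hu with hu | hu
    · simp [hu, abs_of_pos hA]
    · rw [hu, norm_mul, RCLike.norm_conj]
      simp [abs_of_pos hA]
  have hule : ∀ w, ‖u w‖ ≤ A * ‖z‖ * ‖w‖ := fun w => by
    rw [hunorm, mul_assoc]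
    gcongr
    exact norm_inner_le_norm _ _
  have hconj : Continuous fun w => (starRingEnd ℂ) (u w) := Complex.continuous_conj.comp hucont
  have hU : ExpGrowth u := .of_norm_le hucont _ hule
  have hUc : ExpGrowth fun w => (starRingEnd ℂ) (u w) :=
    .of_norm_le hconj (A * ‖z‖) fun w => by simpa using hule w
  have hY : ExpGrowth y := by
    simpa [hy] using (ExpGrowth.const (n := α + 1) (A : ℂ)).mul (ExpGrowth.ofReal_norm.pow 2)
  have hL : ∀ d, ExpGrowth fun w => laguerreSum (k + α) (α + d) (x + y w) := fun d =>
    ((ExpGrowth.const x).add hY).laguerreSum _ _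
  have hHint : ∀ {P : Cn (α + 1) → ℂ}, ExpGrowth P → ∀ d, Integrable fun w => H d w * P w := by
    intro P hP d
    simpa only [hH, hg, mul_assoc] using ExpGrowth.integrable hG hA ((hL d).mul hP)
  have hHm : ∀ d, AEStronglyMeasurable (H d) volume := fun d => by
    simpa using (hHint (ExpGrowth.const 1) d).aestronglyMeasurable
  have hvan : ∀ d (b c : ℕ), b ≠ c →
      ∫ w, H d w * ((starRingEnd ℂ) (u w) ^ b * u w ^ c) = 0 := by
    intro d b c hbc
    rcases hu with hu | hu
    · have := integral_radial_mul_inner_pow_eq_zero (hHU d) z hbc.symm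
      have h2 : ∀ w, H d w * ((starRingEnd ℂ) (u w) ^ b * u w ^ c) = (A : ℂ) ^ (b + c) *
          (H d w * (inner ℂ z w ^ c * (starRingEnd ℂ) (inner ℂ z w) ^ b)) := fun w => by
        rw [hu, map_mul, Complex.conj_ofReal]
        ring
      simp only [h2]
      rw [integral_const_mul, this, mul_zero]
    · have := integral_radial_mul_inner_pow_eq_zero (hHU d) z hbc
      have h2 : ∀ w, H d w * ((starRingEnd ℂ) (u w) ^ b * u w ^ c) = (A : ℂ) ^ (b + c) *
          (H d w * (inner ℂ z w ^ b * (starRingEnd ℂ) (inner ℂ z w) ^ c)) := fun w => by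
        rw [hu, map_mul, Complex.conj_ofReal, Complex.conj_conj]
        ring
      simp only [h2]
      rw [integral_const_mul, this, mul_zero]
  have hmom : ∀ d b : ℕ, ∫ w, H d w * ((‖u w‖ ^ (2 * b) : ℝ) : ℂ) =
      ((b.factorial * α.factorial : ℂ) / (α + b).factorial) * ∫ w, H d w * (x * y w) ^ b := by
    intro d b
    have h1 := integral_radial_mul_norm_inner_pow_eq (hHU d) (hHm d) z b (by
      simpa using hHint (ExpGrowth.ofReal_norm.pow (2 * b)) d)
    have h2 : ∀ w, H d w * ((‖u w‖ ^ (2 * b) : ℝ) : ℂ) = (A : ℂ) ^ (2 * b) *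
        (H d w * ((‖(inner ℂ z w : ℂ)‖ ^ (2 * b) : ℝ) : ℂ)) := fun w => by
      rw [hunorm]
      push_cast
      ring
    have h3 : ∀ w, H d w * (x * y w) ^ b = (A : ℂ) ^ (2 * b) * ((‖z‖ ^ (2 * b) : ℝ) : ℂ) *
        (H d w * ((‖w‖ ^ (2 * b) : ℝ) : ℂ)) := fun w => by
      simp only [hx, hy]
      push_cast
      ring
    simp only [h2, h3]
    rw [integral_const_mul, integral_const_mul, h1]
    ring
  have hexpand : ∀ w, g w * (laguerreSum (k + α) α (x + y w - u w - (starRingEnd ℂ) (u w)) *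
      Complex.exp (u w)) = ∑ b ∈ Finset.range (k + 1), ∑ c ∈ Finset.range (k + 1),
        ((b.factorial : ℂ)⁻¹ * (c.factorial : ℂ)⁻¹) *
          (H (b + c) w * ((starRingEnd ℂ) (u w) ^ b * u w ^ c) * Complex.exp (u w)) := by
    intro w
    rw [laguerreSum_sub (M := k + 1) (by omega), Finset.sum_mul, Finset.mul_sum]
    refine Finset.sum_congr rfl fun b _ => ?_
    rw [laguerreSum_sub (M := k + 1) (by omega), Finset.mul_sum, Finset.sum_mul, Finset.mul_sum]
    refine Finset.sum_congr rfl fun c _ => ?_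
    simp only [hH]
    rw [add_assoc α b c]
    ring
  have hint : ∀ b c, Integrable fun w =>
      ((b.factorial : ℂ)⁻¹ * (c.factorial : ℂ)⁻¹) *
          (H (b + c) w * ((starRingEnd ℂ) (u w) ^ b * u w ^ c) * Complex.exp (u w)) := by
    intro b c
    refine Integrable.const_mul ?_ _
    simpa only [mul_assoc] using hHint (((hUc.pow b).mul (hU.pow c)).mul
      (ExpGrowth.exp_of_norm_le hucont _ hule)) (b + c)
  have hint2 : ∀ b c, Integrable fun w => H (b + c) w *
      ((starRingEnd ℂ) (u w) ^ b * u w ^ c) * Complex.exp (‖u w‖ : ℂ) := by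
    intro b c
    simpa only [mul_assoc] using hHint (((hUc.pow b).mul (hU.pow c)).mul
      (ExpGrowth.exp_of_norm_le (P := fun w => (‖u w‖ : ℂ)) (by fun_prop) (A * ‖z‖)
        (fun w => by simpa using hule w))) (b + c)
  have hXY : ∀ b, ExpGrowth fun w => (x * y w) ^ b := fun b =>
    ((ExpGrowth.const x).mul hY).pow b
  have hinner : ∀ b ∈ Finset.range (k + 1), ∑ c ∈ Finset.range (k + 1),
      ∫ w, ((b.factorial : ℂ)⁻¹ * (c.factorial : ℂ)⁻¹) *
          (H (b + c) w * ((starRingEnd ℂ) (u w) ^ b * u w ^ c) * Complex.exp (u w)) =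
      ∫ w, g w * ((x * y w) ^ b * ((α.factorial : ℂ) / (b.factorial * (α + b).factorial)) *
        laguerreSum (k + α + b) (α + 2 * b) (x + y w)) := by
    intro b hb
    rw [Finset.mem_range] at hb
    have h1 : ∀ c ∈ Finset.range (k + 1), ∫ w, ((b.factorial : ℂ)⁻¹ * (c.factorial : ℂ)⁻¹) *
          (H (b + c) w * ((starRingEnd ℂ) (u w) ^ b * u w ^ c) * Complex.exp (u w)) =
        if c ≤ b then ∫ w, ((α.factorial : ℂ) / (b.factorial * (α + b).factorial) *
          (b.choose c : ℕ)) * (H (b + c) w * (x * y w) ^ b) else 0 := by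
      intro c _
      rw [integral_const_mul, integral_mul_conj_pow_mul_pow_mul_exp (hHm _) hucont (hvan _) b c
        (hint2 b c)]
      split_ifs with hcb
      · rw [hmom, integral_const_mul, Nat.cast_choose ℂ hcb]
        have := hf b
        have := hf c
        have := hf (b - c)
        have := hf (α + b)
        field_simp
      · rw [mul_zero]
    rw [Finset.sum_congr rfl h1, ← Finset.sum_filter,
      show (Finset.range (k + 1)).filter (fun c => c ≤ b) = Finset.range (b + 1) by
        ext c; simp only [Finset.mem_filter, Finset.mem_range]; omega,
      ← integral_finsetSum _ fun c _ => (hHint (hXY b) (b + c)).const_mul _]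
    congr 1
    ext w
    rw [← sum_choose_mul_laguerreSum, Finset.mul_sum, Finset.mul_sum]
    refine Finset.sum_congr rfl fun c _ => ?_
    simp only [hH]
    rw [add_assoc α b c]
    ring
  have hfin : ∀ w, ∑ b ∈ Finset.range (k + 1), g w * ((x * y w) ^ b *
      ((α.factorial : ℂ) / (b.factorial * (α + b).factorial)) *
        laguerreSum (k + α + b) (α + 2 * b) (x + y w)) =
      ((k.factorial : ℂ) * α.factorial / (k + α).factorial * laguerreSum (k + α) α x) *
        (g w * laguerreSum (k + α) α (y w)) := by
    intro w
    rw [← Finset.mul_sum, sum_laguerreSum_eq_mul]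
    ring
  refine (integral_congr_ae (Eventually.of_forall hexpand)).trans ?_
  rw [integral_finsetSum _ fun b _ => integrable_finsetSum _ fun c _ => hint b c,
    Finset.sum_congr rfl fun b _ => integral_finsetSum _ fun c _ => hint b c,
    Finset.sum_congr rfl hinner, ← integral_finsetSum]
  · simp only [hfin]
    rw [integral_const_mul]
    ring
  · intro b _
    simpa only [hg, mul_assoc] using ExpGrowth.integrable hG hA
      ((hXY b).mul ((ExpGrowth.const _).mul
        (((ExpGrowth.const x).add hY).laguerreSum (k + α + b) (α + 2 * b))))

theorem lagFun_succ (α k : ℕ) (lam : ℝ) (w : Cn (α + 1)) :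
    ((lagFun (α + 1) k lam w : ℝ) : ℂ) =
      ((Real.exp (-(|lam| / 2 * ‖w‖ ^ 2 / 2)) : ℝ) : ℂ) *
        laguerreSum (k + α) α ((|lam| / 2 * ‖w‖ ^ 2 : ℝ) : ℂ) := by
  rw [laguerreSum_eq_sum_range (M := k + 1) (by omega), lagFun, lagPoly, mul_comm]
  push_cast
  congr 1
  · congr 1
    ring
  · refine Finset.sum_congr rfl fun j hj => ?_
    rw [Finset.mem_range] at hj
    rw [show k + (α + 1) - 1 = k + α by omega, ← Nat.choose_symm (show α + j ≤ k + α by omega),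
      show k + α - (α + j) = k - j by omega, mul_div_assoc]
    congr 4
    ring

theorem imZW_eq_neg_im_inner {n : ℕ} (v w : Cn n) : imZW v w = -(inner ℂ v w : ℂ).im := by
  rw [← inner_conj_symm, Complex.conj_im, neg_neg, imZW, PiLp.inner_apply]
  rfl

theorem normSq_sub_eq {n : ℕ} (v w : Cn n) :
    ((‖v - w‖ ^ 2 : ℝ) : ℂ) = ((‖v‖ ^ 2 : ℝ) : ℂ) + ((‖w‖ ^ 2 : ℝ) : ℂ) - inner ℂ v w -
      (starRingEnd ℂ) (inner ℂ v w) := by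
  rw [norm_sub_sq (𝕜 := ℂ) v w, sub_sub, Complex.add_conj]
  push_cast
  simp
  ring

theorem integral_radial_mul_lagFun_sub {n : ℕ} (hn : 1 ≤ n) (k : ℕ) {lam : ℝ} (hlam : lam ≠ 0)
    {G : Cn n → ℂ} (hG : Integrable G) (hrad : ∀ (U : Cn n ≃ₗᵢ[ℂ] Cn n) w, G (U w) = G w)
    (v : Cn n) :
    ∫ w, G w * ((lagFun n k lam (v - w) : ℝ) : ℂ) *
        Complex.exp (-(Complex.I / 2 * lam * ((imZW v w : ℝ) : ℂ))) =
      ((normC n k : ℝ) : ℂ) * (∫ w, G w * ((lagFun n k lam w : ℝ) : ℂ)) *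
        ((lagFun n k lam v : ℝ) : ℂ) := by
  obtain ⟨α, rfl⟩ : ∃ α, n = α + 1 := ⟨n - 1, by omega⟩
  set A : ℝ := |lam| / 2 with hA
  have hA0 : 0 < A := by positivity
  obtain ⟨u, hu, hphase⟩ : ∃ u : Cn (α + 1) → ℂ,
      ((∀ w, u w = A * inner ℂ v w) ∨ (∀ w, u w = A * (starRingEnd ℂ) (inner ℂ v w))) ∧
      ∀ w, -(Complex.I / 2 * lam * ((imZW v w : ℝ) : ℂ)) = (u w - (starRingEnd ℂ) (u w)) / 2 := by
    rcases lt_or_gt_of_ne hlam with h | h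
    · refine ⟨_, Or.inr fun _ => rfl, fun w => ?_⟩
      rw [imZW_eq_neg_im_inner, map_mul, Complex.conj_conj, Complex.conj_ofReal, hA, abs_of_neg h,
        ← mul_sub, ← neg_sub (inner ℂ v w : ℂ), Complex.sub_conj]
      push_cast
      ring
    · refine ⟨_, Or.inl fun _ => rfl, fun w => ?_⟩
      rw [imZW_eq_neg_im_inner, map_mul, Complex.conj_ofReal, hA, abs_of_pos h,
        ← mul_sub, Complex.sub_conj]
      push_cast
      ring
  have hsum : ∀ w, u w + (starRingEnd ℂ) (u w) =
      A * (inner ℂ v w + (starRingEnd ℂ) (inner ℂ v w)) := fun w => by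
    rcases hu with hu | hu <;> rw [hu, map_mul, Complex.conj_ofReal]
    · ring
    · rw [Complex.conj_conj]
      ring
  have hnorm : ∀ w, ((A * ‖v - w‖ ^ 2 : ℝ) : ℂ) =
      ((A * ‖v‖ ^ 2 : ℝ) : ℂ) + ((A * ‖w‖ ^ 2 : ℝ) : ℂ) - u w - (starRingEnd ℂ) (u w) := by
    intro w
    rw [sub_sub, hsum, Complex.ofReal_mul, normSq_sub_eq]
    push_cast
    ring
  have hpt : ∀ w, G w * ((lagFun (α + 1) k lam (v - w) : ℝ) : ℂ) *
        Complex.exp (-(Complex.I / 2 * lam * ((imZW v w : ℝ) : ℂ))) =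
      ((Real.exp (-(A * ‖v‖ ^ 2 / 2)) : ℝ) : ℂ) *
      (G w * ((Real.exp (-(A * ‖w‖ ^ 2 / 2)) : ℝ) : ℂ) *
        (laguerreSum (k + α) α (((A * ‖v‖ ^ 2 : ℝ) : ℂ) + ((A * ‖w‖ ^ 2 : ℝ) : ℂ) - u w -
          (starRingEnd ℂ) (u w)) * Complex.exp (u w))) := by
    intro w
    have hexp : ((Real.exp (-(A * ‖v - w‖ ^ 2 / 2)) : ℝ) : ℂ) *
        Complex.exp ((u w - (starRingEnd ℂ) (u w)) / 2) =
        ((Real.exp (-(A * ‖v‖ ^ 2 / 2)) : ℝ) : ℂ) * ((Real.exp (-(A * ‖w‖ ^ 2 / 2)) : ℝ) : ℂ) *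
          Complex.exp (u w) := by
      rw [Complex.ofReal_exp, Complex.ofReal_exp, Complex.ofReal_exp, ← Complex.exp_add,
        ← Complex.exp_add, ← Complex.exp_add]
      have := hnorm w
      congr 1
      rw [Complex.ofReal_neg, Complex.ofReal_div, this]
      push_cast
      ring
    rw [lagFun_succ, hphase, ← hA, ← hnorm]
    linear_combination (G w * laguerreSum (k + α) α ((A * ‖v - w‖ ^ 2 : ℝ) : ℂ)) * hexp
  simp only [hpt]
  rw [integral_const_mul, integral_radial_mul_laguerreSum_mul_exp k hG hrad hA0 v hu]
  simp only [lagFun_succ, ← hA, ← mul_assoc, normC]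
  rw [show k + (α + 1) - 1 = k + α by omega, Nat.add_sub_cancel]
  push_cast
  ring

theorem continuous_lagFun (n k : ℕ) (lam : ℝ) : Continuous (lagFun n k lam) := by
  unfold lagFun lagPoly
  fun_prop

theorem abs_lagFun_le (n k : ℕ) (lam : ℝ) : ∃ C : ℝ, ∀ z, |lagFun n k lam z| ≤ C := by
  refine ⟨∑ j ∈ Finset.range (k + 1), ((k + n - 1).choose (k - j) : ℝ) * 2 ^ j, fun z => ?_⟩
  set x : ℝ := |lam| * ‖z‖ ^ 2 / 4 with hx
  have hx0 : 0 ≤ x := by positivity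
  have h2 : |lam| * ‖z‖ ^ 2 / 2 = 2 * x := by rw [hx]; ring
  rw [lagFun, lagPoly, h2, Finset.sum_mul]
  refine (Finset.abs_sum_le_sum_abs _ _).trans (Finset.sum_le_sum fun j _ => ?_)
  have hj := Real.pow_div_factorial_le_exp x hx0 j
  rw [abs_mul, abs_div, abs_mul, abs_pow, abs_neg, abs_of_nonneg (by positivity : 0 ≤ 2 * x),
    Nat.abs_cast, Nat.abs_cast, abs_of_pos (Real.exp_pos _), mul_pow, Real.exp_neg,
    ← div_eq_mul_inv, div_le_iff₀ (Real.exp_pos _)]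
  calc ((k + n - 1).choose (k - j) : ℝ) * (2 ^ j * x ^ j) / j.factorial
      = ((k + n - 1).choose (k - j) : ℝ) * 2 ^ j * (x ^ j / j.factorial) := by ring
    _ ≤ _ := by gcongr

theorem lagFun_neg (n k : ℕ) (lam : ℝ) : lagFun n k (-lam) = lagFun n k lam := by
  funext w
  simp [lagFun]

theorem continuous_imZW (n : ℕ) : Continuous fun p : Cn n × Cn n => imZW p.1 p.2 := by
  simp only [imZW_eq_neg_im_inner]
  exact (Complex.continuous_im.comp (continuous_fst.inner continuous_snd)).neg

theorem norm_exp_I_mul_ofReal_mul_ofReal (a b : ℝ) :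
    ‖Complex.exp (Complex.I * (a : ℂ) * (b : ℂ))‖ = 1 := by
  rw [mul_assoc, ← Complex.ofReal_mul, mul_comm, Complex.norm_exp_ofReal_mul_I]

theorem measurePreserving_heisenberg_div {n : ℕ} (y : Hn n) :
    MeasurePreserving (fun x : Hn n => ((x.1 - y.1, x.2 - y.2 - imZW x.1 y.1 / 2) : Hn n)) := by
  refine MeasurePreserving.skew_product (measurePreserving_sub_right volume y.1)
    (g := fun v t => t - y.2 - imZW v y.1 / 2) ?_ (Eventually.of_forall fun v => ?_)
  · have h1 : Measurable fun p : Cn n × ℝ => imZW p.1 y.1 :=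
      ((continuous_imZW n).comp (continuous_fst.prodMk continuous_const)).measurable
    exact (measurable_snd.sub_const _).sub (h1.div_const 2)
  · simp only [sub_sub]
    exact (measurePreserving_sub_right volume (y.2 + imZW v y.1 / 2)).map_eq

theorem measurePreserving_heisenberg_prod (n : ℕ) :
    MeasurePreserving (fun p : Hn n × Hn n =>
      ((p.1, (p.2.1 - p.1.1, p.2.2 - p.1.2 - imZW p.2.1 p.1.1 / 2)) : Hn n × Hn n)) := by
  refine MeasurePreserving.skew_product (MeasurePreserving.id volume)
    (g := fun (y x : Hn n) => ((x.1 - y.1, x.2 - y.2 - imZW x.1 y.1 / 2) : Hn n)) ?_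
    (Eventually.of_forall fun y => (measurePreserving_heisenberg_div y).map_eq)
  have h1 : Measurable fun p : Hn n × Hn n => imZW p.2.1 p.1.1 :=
    ((continuous_imZW n).comp
      ((continuous_fst.comp continuous_snd).prodMk (continuous_fst.comp continuous_fst))).measurable
  exact (((measurable_fst.comp measurable_snd).sub (measurable_fst.comp measurable_fst))).prodMk
    (((measurable_snd.comp measurable_snd).sub (measurable_snd.comp measurable_fst)).sub
      (h1.div_const 2))

theorem integrable_heisenberg_convolution_integrand {n : ℕ} {f g : Hn n → ℂ} (hf : Integrable f)
    (hg : Integrable g) : Integrable fun p : Hn n × Hn n =>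
      f (p.1.1 - p.2.1, p.1.2 - p.2.2 - imZW p.1.1 p.2.1 / 2) * g p.2 := by
  have h := ((measurePreserving_heisenberg_prod n).integrable_comp
    (hg.mul_prod hf).aestronglyMeasurable).2 (hg.mul_prod hf)
  refine h.swap.congr (Eventually.of_forall fun p => ?_)
  simp [mul_comm]

theorem integrable_exp_mul {n : ℕ} {f : Hn n → ℂ} (hf : Integrable f) (μ : ℝ) :
    Integrable fun x : Hn n => Complex.exp (Complex.I * (μ : ℂ) * (x.2 : ℂ)) * f x :=
  hf.bdd_mul (c := 1) (Continuous.aestronglyMeasurable (by fun_prop))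
    (Eventually.of_forall fun _ => (norm_exp_I_mul_ofReal_mul_ofReal _ _).le)

theorem integrable_fLam {n : ℕ} {f : Hn n → ℂ} (hf : Integrable f) (μ : ℝ) :
    Integrable (fLam n f μ) :=
  (integrable_exp_mul hf μ).integral_prod_left

theorem fLam_hConv {n : ℕ} {f g : Hn n → ℂ} (hf : Integrable f) (hg : Integrable g) (μ : ℝ) :
    fLam n (hConv n f g) μ =ᵐ[volume] twConv n μ (fLam n f μ) (fLam n g μ) := by
  have hint := integrable_heisenberg_convolution_integrand hf hg
  have hassoc := ((measurePreserving_prodAssoc (volume : Measure (Cn n)) (volume : Measure ℝ)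
    (volume : Measure (Hn n))).symm.integrable_comp_emb
      (MeasurableEquiv.measurableEmbedding _)).2 hint
  filter_upwards [hassoc.prod_right_ae] with v hv
  have hv' : Integrable (Function.uncurry fun (t : ℝ) (y : Hn n) =>
      Complex.exp (Complex.I * (μ : ℂ) * (t : ℂ)) *
        (f (v - y.1, t - y.2 - imZW v y.1 / 2) * g y)) :=
    hv.bdd_mul (c := 1) (Continuous.aestronglyMeasurable (by fun_prop))
      (Eventually.of_forall fun _ => (norm_exp_I_mul_ofReal_mul_ofReal _ _).le)
  have hinner : ∀ y : Hn n, ∫ t : ℝ, Complex.exp (Complex.I * (μ : ℂ) * (t : ℂ)) *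
        (f (v - y.1, t - y.2 - imZW v y.1 / 2) * g y) =
      fLam n f μ (v - y.1) * Complex.exp (Complex.I / 2 * (μ : ℂ) * ((imZW v y.1 : ℝ) : ℂ)) *
        (Complex.exp (Complex.I * (μ : ℂ) * (y.2 : ℂ)) * g y) := by
    intro y
    rw [← integral_add_right_eq_self _ (y.2 + imZW v y.1 / 2), fLam, ← integral_mul_const,
      ← integral_mul_const]
    congr 1
    ext t
    rw [show t + (y.2 + imZW v y.1 / 2) - y.2 - imZW v y.1 / 2 = t by ring,
      show Complex.I * (μ : ℂ) * ((t + (y.2 + imZW v y.1 / 2) : ℝ) : ℂ) =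
        Complex.I * μ * t + Complex.I * μ * y.2 + Complex.I / 2 * μ * (imZW v y.1 : ℝ) by
          push_cast; ring, Complex.exp_add, Complex.exp_add]
    ring
  have hy := hv'.integral_prod_right
  simp only [Function.uncurry_apply_pair, hinner] at hy
  calc fLam n (hConv n f g) μ v
      = ∫ t : ℝ, ∫ y : Hn n, Complex.exp (Complex.I * (μ : ℂ) * (t : ℂ)) *
        (f (v - y.1, t - y.2 - imZW v y.1 / 2) * g y) := by
        simp only [fLam, hConv, integral_const_mul]
    _ = ∫ y : Hn n, fLam n f μ (v - y.1) *
        Complex.exp (Complex.I / 2 * (μ : ℂ) * ((imZW v y.1 : ℝ) : ℂ)) *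
        (Complex.exp (Complex.I * (μ : ℂ) * (y.2 : ℂ)) * g y) := by
        rw [integral_integral_swap hv']
        simp only [hinner]
    _ = twConv n μ (fLam n f μ) (fLam n g μ) v := by
        rw [Measure.volume_eq_prod, integral_prod _ hy, twConv]
        congr 1
        ext w
        simp only [integral_const_mul]
        rw [← fLam]
        ring

theorem fLam_comp_unitary {n : ℕ} {g : Hn n → ℂ} (hrad : IsRadial n g) (μ : ℝ)
    (U : Cn n ≃ₗᵢ[ℂ] Cn n) (w : Cn n) : fLam n g μ (U w) = fLam n g μ w := by
  simp only [fLam, fun t => hrad U (w, t)]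

theorem imZW_add_left {n : ℕ} (a b c : Cn n) : imZW (a + b) c = imZW a c + imZW b c := by
  simp only [imZW_eq_neg_im_inner, inner_add_left, Complex.add_im, neg_add]

theorem imZW_add_right {n : ℕ} (a b c : Cn n) : imZW a (b + c) = imZW a b + imZW a c := by
  simp only [imZW_eq_neg_im_inner, inner_add_right, Complex.add_im, neg_add]

theorem imZW_self {n : ℕ} (a : Cn n) : imZW a a = 0 := by
  rw [imZW_eq_neg_im_inner, ← inner_self_ofReal_re]
  exact neg_eq_zero.2 (Complex.ofReal_im _)

theorem twConv_congr_left {n : ℕ} (μ : ℝ) {F F' : Cn n → ℂ} (h : F =ᵐ[volume] F') (G : Cn n → ℂ)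
    (z : Cn n) : twConv n μ F G z = twConv n μ F' G z := by
  refine integral_congr_ae ?_
  have hmp := Measure.measurePreserving_sub_left (volume : Measure (Cn n)) z
  filter_upwards [hmp.quasiMeasurePreserving.ae h] with w hw
  rw [hw]

theorem twConv_twConv_lagFun {n : ℕ} (hn : 1 ≤ n) (k : ℕ) {μ : ℝ} (hμ : μ ≠ 0) {F G : Cn n → ℂ}
    (hF : Integrable F) (hG : Integrable G)
    (hrad : ∀ (U : Cn n ≃ₗᵢ[ℂ] Cn n) w, G (U w) = G w) (z : Cn n) :
    twConv n μ (twConv n μ F G) (fun w => ((lagFun n k μ w : ℝ) : ℂ)) z =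
      ((normC n k : ℝ) : ℂ) * (∫ w, G w * ((lagFun n k μ w : ℝ) : ℂ)) *
        twConv n μ F (fun w => ((lagFun n k μ w : ℝ) : ℂ)) z := by
  set φ : Cn n → ℂ := fun w => ((lagFun n k μ w : ℝ) : ℂ) with hφ
  set e : Cn n → Cn n → ℂ := fun a b =>
    Complex.exp (Complex.I / 2 * (μ : ℂ) * ((imZW a b : ℝ) : ℂ)) with he
  set e' : Cn n → Cn n → ℂ := fun a b =>
    Complex.exp (-(Complex.I / 2 * (μ : ℂ) * ((imZW a b : ℝ) : ℂ))) with he'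
  obtain ⟨C, hC⟩ := abs_lagFun_le n k μ
  have hφc : Continuous φ := Complex.continuous_ofReal.comp (continuous_lagFun n k μ)
  have hnorm : ∀ a b, ‖e a b‖ = 1 := fun a b => by
    have := norm_exp_I_mul_ofReal_mul_ofReal (μ / 2) (imZW a b)
    rw [← this, he]
    push_cast
    ring_nf
  have hnorm' : ∀ a b, ‖e' a b‖ = 1 := fun a b => by
    rw [← inv_one, ← hnorm a b, ← norm_inv, ← Complex.exp_neg]
  have hcont : Continuous fun p : Cn n × Cn n => e p.1 p.2 :=
    Complex.continuous_exp.comp (continuous_const.mul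
      (Complex.continuous_ofReal.comp (continuous_imZW n)))
  have hcont' : Continuous fun p : Cn n × Cn n => e' p.1 p.2 :=
    Complex.continuous_exp.comp (continuous_const.mul
      (Complex.continuous_ofReal.comp (continuous_imZW n))).neg
  set K : Cn n × Cn n → ℂ := fun p =>
    (φ (p.1 - p.2) * e z p.1 * e' p.1 p.2) * (F (z - p.1) * G p.2) with hK
  have hKint : Integrable K := by
    refine ((hF.comp_sub_left z).mul_prod hG).bdd_mul (c := C) ?_ (Eventually.of_forall fun p => ?_)
    · exact (((hφc.comp (continuous_fst.sub continuous_snd)).mul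
        (hcont.comp (continuous_const.prodMk continuous_fst))).mul hcont').aestronglyMeasurable
    · rw [norm_mul, norm_mul, hnorm, hnorm', mul_one, mul_one, hφ, Complex.norm_real]
      exact hC _
  have hmp : MeasurePreserving (fun p : Cn n × Cn n => (p.1 + p.2, p.2)) :=
    measurePreserving_add_prod volume volume
  have hphase : ∀ w w', e (z - w) w' * e z w = e z (w + w') * e' (w + w') w' := by
    intro w w'
    simp only [he, he', ← Complex.exp_add]
    congr 1
    have h1 := imZW_add_left (z - w) w w'
    rw [sub_add_cancel] at h1
    rw [imZW_add_right, imZW_add_left, imZW_self, h1]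
    push_cast
    ring
  calc twConv n μ (twConv n μ F G) φ z
      = ∫ w, ∫ w', K (w + w', w') := by
        rw [twConv]
        congr 1
        ext w
        rw [twConv, ← integral_mul_const, ← integral_mul_const]
        congr 1
        ext w'
        have := hphase w w'
        simp only [hK, add_sub_cancel_right, sub_add_eq_sub_sub]
        linear_combination (F (z - w - w') * G w' * φ w) * this
    _ = ∫ p, K p := by
        rw [← hmp.map_eq, integral_map hmp.aemeasurable (by rw [hmp.map_eq]; exact hKint.1),
          Measure.volume_eq_prod, integral_prod]
        exact (hmp.integrable_comp hKint.1).2 hKint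
    _ = ∫ v, F (z - v) * e z v * ∫ w', G w' * φ (v - w') * e' v w' := by
        rw [Measure.volume_eq_prod, integral_prod _ hKint]
        congr 1
        ext v
        rw [← integral_const_mul]
        congr 1
        ext w'
        simp only [hK]
        ring
    _ = _ := by
        simp only [hφ, he', integral_radial_mul_lagFun_sub hn k hμ hG hrad]
        rw [twConv, ← integral_const_mul (((normC n k : ℝ) : ℂ) * _)]
        congr 1
        ext v
        ring

/-- For f ∈ L¹(ℍⁿ) and g ∈ L¹(ℍⁿ) radial, the Strichartz Fourier transform of the convolution
satisfies (f∗g)̂(a,z) = R_k(−λ,g) f̂(a,z). -/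
theorem strichartz_convolution_radial (n : ℕ) (hn : 1 ≤ n) (f g : Hn n → ℂ)
    (hf : Integrable f (volume : Measure (Hn n)))
    (hg : Integrable g (volume : Measure (Hn n))) (hrad : IsRadial n g)
    (k : ℕ) (lam : ℝ) (hlam : lam ≠ 0) (z : Cn n) :
    stri n (hConv n f g) k lam z = lagCoef n k (-lam) g * stri n f k lam z := by
  have h := twConv_twConv_lagFun hn k (neg_ne_zero.2 hlam) (integrable_fLam hf (-lam))
    (integrable_fLam hg (-lam)) (fLam_comp_unitary hrad (-lam)) z
  rw [stri, stri, lagCoef, twConv_congr_left (-lam) (fLam_hConv hf hg (-lam))]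
  rw [lagFun_neg] at h ⊢
  exact h
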